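/- Let H₀ be a complex Hilbert space, let A be a C*-subalgebra of B(H₀), let J ⊆ A be a closed two-sided ideal of A, and let X be a closed linear subspace of B(H₀) such that a∘x ∈ X for all a ∈ A and x ∈ X, and such that the closed linear span of {a∘x : a ∈ A, x ∈ X} equals X (the action of A is nondegenerate). If the closed linear span of {j∘x : j ∈ J, x ∈ X} is a proper subspace of X, then there exist a complex Hilbert space H and a unital *-homomorphism Φ : B(H₀) → B(H) such that the closed linear span of {Φ(j)(Φ(x)h) : j ∈ J, x ∈ X, h ∈ H} is a proper subspace of the closed linear span of {Φ(x)h : x ∈ X, h ∈ H}. -/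

import Mathlib

open Filter Topology ComplexOrder in
/-- A closed subspace `J` of a C⋆-algebra with `J J ⊆ J` and `J J⋆ ⊆ J` has a contractive left
approximate unit. -/
theorem exists_contractive_left_approximateUnit {R : Type*} [NonUnitalCStarAlgebra R]
    (J : Submodule ℂ R) (hJ : IsClosed (J : Set R)) (hmul : ∀ a ∈ J, ∀ b ∈ J, a * b ∈ J)
    (hstar : ∀ a ∈ J, ∀ b ∈ J, a * star b ∈ J) :
    ∃ l : Filter R, l.NeBot ∧ (∀ᶠ e in l, e ∈ J ∧ ‖e‖ ≤ 1) ∧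
      ∀ j ∈ J, Tendsto (fun e ↦ e * j) l (𝓝 j) := by
  let B : NonUnitalStarSubalgebra ℂ R :=
    { carrier := {b | b ∈ J ∧ star b ∈ J}
      add_mem' := fun ha hb ↦ ⟨J.add_mem ha.1 hb.1, by
        rw [star_add]; exact J.add_mem ha.2 hb.2⟩
      zero_mem' := by simp
      mul_mem' := fun ha hb ↦ ⟨hmul _ ha.1 _ hb.1, by
        rw [star_mul]; exact hmul _ hb.2 _ ha.2⟩
      smul_mem' := fun c a ha ↦ ⟨J.smul_mem c ha.1, by
        rw [star_smul]; exact J.smul_mem _ ha.2⟩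
      star_mem' := fun ha ↦ ⟨ha.2, by simpa using ha.1⟩ }
  have hB : IsClosed (B : Set R) := hJ.inter (hJ.preimage continuous_star)
  let _ : NonUnitalCStarAlgebra B :=
    NonUnitalStarSubalgebra.nonUnitalCStarAlgebra B (h_closed := hB)
  let _ : PartialOrder B := CStarAlgebra.spectralOrder B
  have : StarOrderedRing B := CStarAlgebra.spectralOrderedRing B
  have hu := CStarAlgebra.increasingApproximateUnit B
  have := hu.neBot
  refine ⟨map ((↑) : B → R) (CStarAlgebra.approximateUnit B), inferInstance, ?_, fun j hj ↦ ?_⟩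
  · rw [eventually_map]
    filter_upwards [hu.eventually_norm] with e he
    exact ⟨e.2.1, he⟩
  rw [tendsto_map'_iff, tendsto_iff_norm_sub_tendsto_zero]
  have hjj : j * star j ∈ B := ⟨hstar j hj j hj, by simpa using hstar j hj j hj⟩
  have h1 : Tendsto (fun e : B ↦ ‖(e : R) * (j * star j) - j * star j‖)
      (CStarAlgebra.approximateUnit B) (𝓝 0) := by
    have := tendsto_iff_norm_sub_tendsto_zero.1 (hu.tendsto_mul_right ⟨_, hjj⟩)
    exact this
  have h2 : Tendsto (fun e : B ↦ √(2 * ‖(e : R) * (j * star j) - j * star j‖))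
      (CStarAlgebra.approximateUnit B) (𝓝 0) := by
    simpa using (h1.const_mul 2).sqrt
  refine squeeze_zero' (Eventually.of_forall fun _ ↦ norm_nonneg _) ?_ h2
  filter_upwards [hu.eventually_norm] with e he
  refine Real.le_sqrt_of_sq_le ?_
  have he' : ‖(e : R)‖ ≤ 1 := he
  have hexp : ((e : R) * j - j) * star ((e : R) * j - j) =
      ((e : R) * (j * star j) - j * star j) * star (e : R)
        - ((e : R) * (j * star j) - j * star j) := by
    simp only [star_sub, star_mul]; noncomm_ring
  calc ‖(e : R) * j - j‖ ^ 2 = ‖((e : R) * j - j) * star ((e : R) * j - j)‖ := by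
        rw [CStarRing.norm_self_mul_star, sq]
    _ ≤ ‖((e : R) * (j * star j) - j * star j)‖ * ‖star (e : R)‖
          + ‖((e : R) * (j * star j) - j * star j)‖ := by
        rw [hexp]
        exact (norm_sub_le _ _).trans (add_le_add_left (norm_mul_le _ _) _)
    _ ≤ 2 * ‖(e : R) * (j * star j) - j * star j‖ := by
        rw [norm_star]
        nlinarith [norm_nonneg ((e : R) * (j * star j) - j * star j)]

open Filter Topology ComplexOrder in
/-- The limit of the vector functionals of a bounded family of vectors along an ultrafilter. -/
theorem exists_positiveLinearMap_tendsto_inner {ι H : Type*} [NormedAddCommGroup H]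
    [InnerProductSpace ℂ H] [CompleteSpace H] (U : Ultrafilter ι) (h : ι → H)
    (hh : ∀ i, ‖h i‖ ≤ 1) :
    ∃ φ : (H →L[ℂ] H) →ₚ[ℂ] ℂ,
      ∀ T : H →L[ℂ] H, Tendsto (fun i ↦ inner ℂ (h i) (T (h i))) U (𝓝 (φ T)) := by
  have hex (T : H →L[ℂ] H) : ∃ z, Tendsto (fun i ↦ inner ℂ (h i) (T (h i))) U (𝓝 z) := by
    have hb : ∀ i, inner ℂ (h i) (T (h i)) ∈ Metric.closedBall (0 : ℂ) ‖T‖ := fun i ↦ by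
      rw [mem_closedBall_zero_iff]
      calc ‖inner ℂ (h i) (T (h i))‖ ≤ ‖h i‖ * ‖T (h i)‖ := norm_inner_le_norm _ _
        _ ≤ 1 * (‖T‖ * 1) := by
          gcongr
          · exact hh i
          · exact T.le_opNorm_of_le (hh i)
        _ = ‖T‖ := by ring
    obtain ⟨z, -, hz⟩ := (isCompact_closedBall (0 : ℂ) ‖T‖).ultrafilter_le_nhds
      (U.map fun i ↦ inner ℂ (h i) (T (h i)))
      (le_principal_iff.2 (Filter.mem_map.2 (Eventually.of_forall hb)))
    exact ⟨z, hz⟩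
  choose f hf using hex
  refine ⟨.mk₀ { toFun := f, map_add' := fun S T ↦ ?_, map_smul' := fun c T ↦ ?_ }
    fun T hT ↦ ?_, hf⟩
  · refine tendsto_nhds_unique (hf (S + T)) ?_
    simpa [inner_add_right] using (hf S).add (hf T)
  · refine tendsto_nhds_unique (hf (c • T)) ?_
    simpa [inner_smul_right] using (hf T).const_mul c
  · exact ge_of_tendsto' (hf T) fun i ↦
      ((ContinuousLinearMap.nonneg_iff_isPositive T).1 hT).inner_nonneg_right (h i)

open Filter Topology in
/-- A family of contractions converging pointwise to the identity on a set does so on its closed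
linear span. -/
theorem tendsto_apply_of_mem_topologicalClosure_span {ι H : Type*} [NormedAddCommGroup H]
    [NormedSpace ℂ H] {l : Filter ι} {T : ι → H →L[ℂ] H} (hT : ∀ᶠ i in l, ‖T i‖ ≤ 1)
    {S : Set H} (hS : ∀ v ∈ S, Tendsto (fun i ↦ T i v) l (𝓝 v)) {v : H}
    (hv : v ∈ (Submodule.span ℂ S).topologicalClosure) :
    Tendsto (fun i ↦ T i v) l (𝓝 v) := by
  have hspan : ∀ w ∈ Submodule.span ℂ S, Tendsto (fun i ↦ T i w) l (𝓝 w) := fun w hw ↦ by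
    induction hw using Submodule.span_induction with
    | mem w hw => exact hS w hw
    | zero => simpa using tendsto_const_nhds
    | add a b _ _ ha hb => simpa using ha.add hb
    | smul c a _ ha => simpa using ha.const_smul c
  rw [Metric.tendsto_nhds]
  intro ε hε
  obtain ⟨w, hw, hvw⟩ := Metric.mem_closure_iff.1 hv (ε / 3) (by positivity)
  filter_upwards [hT, Metric.tendsto_nhds.1 (hspan w hw) (ε / 3) (by positivity)] with i hi hiw
  have h1 : dist (T i v) (T i w) ≤ dist v w := by
    rw [dist_eq_norm, dist_eq_norm, ← map_sub]
    simpa using (T i).le_of_opNorm_le hi (v - w)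
  rw [dist_comm] at hvw
  calc dist (T i v) v ≤ dist (T i v) (T i w) + dist (T i w) w + dist w v := dist_triangle4 _ _ _ _
    _ < ε := by linarith [dist_comm v w]

open Filter Topology ComplexOrder in
/-- Dessi–Kakariadis–Paraskevas, concrete form: Let `A` be a C*-subalgebra of
`B(H₀)`, `J ⊆ A` a closed two-sided ideal of `A`, and `X ⊆ B(H₀)` a closed `A`-invariant
subspace on which `A` acts nondegenerately.  If `J` acts degenerately on `X`, then there exist
a Hilbert space `H` and a unital *-homomorphism `Φ : B(H₀) → B(H)` witnessing spatial
degeneracy of the action of `J`. -/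
theorem ideal_degenerate_action_spatially_degenerate
    {H₀ : Type u} [NormedAddCommGroup H₀] [InnerProductSpace ℂ H₀] [CompleteSpace H₀]
    (A : NonUnitalStarSubalgebra ℂ (H₀ →L[ℂ] H₀)) (hA : IsClosed (A : Set (H₀ →L[ℂ] H₀)))
    (J : Submodule ℂ (H₀ →L[ℂ] H₀)) (hJ : IsClosed (J : Set (H₀ →L[ℂ] H₀)))
    (hJA : (J : Set (H₀ →L[ℂ] H₀)) ⊆ (A : Set (H₀ →L[ℂ] H₀)))
    (hideal : ∀ a ∈ A, ∀ j ∈ J, a * j ∈ J ∧ j * a ∈ J)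
    (X : Submodule ℂ (H₀ →L[ℂ] H₀)) (hX : IsClosed (X : Set (H₀ →L[ℂ] H₀)))
    (hAX : ∀ a ∈ A, ∀ x ∈ X, a * x ∈ X)
    (hnondeg : (Submodule.span ℂ
        {y : H₀ →L[ℂ] H₀ | ∃ a ∈ A, ∃ x ∈ X, y = a * x}).topologicalClosure = X)
    (hdeg : (Submodule.span ℂ
        {y : H₀ →L[ℂ] H₀ | ∃ j ∈ J, ∃ x ∈ X, y = j * x}).topologicalClosure < X) :
    ∃ (H : Type u) (_ : NormedAddCommGroup H) (_ : InnerProductSpace ℂ H) (_ : CompleteSpace H)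
      (Φ : (H₀ →L[ℂ] H₀) →⋆ₐ[ℂ] (H →L[ℂ] H)),
      (Submodule.span ℂ
          {v : H | ∃ j ∈ J, ∃ x ∈ X, ∃ h : H, v = Φ j (Φ x h)}).topologicalClosure <
        (Submodule.span ℂ {v : H | ∃ x ∈ X, ∃ h : H, v = Φ x h}).topologicalClosure := by
  obtain ⟨-, x, hx, hxJ⟩ := SetLike.lt_iff_le_and_exists.1 hdeg
  set Y := (Submodule.span ℂ
    {y : H₀ →L[ℂ] H₀ | ∃ j ∈ J, ∃ x ∈ X, y = j * x}).topologicalClosure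
  have hYmem : ∀ j ∈ J, ∀ x ∈ X, j * x ∈ Y := fun j hj x hx ↦
    Submodule.le_topologicalClosure _ (Submodule.subset_span ⟨j, hj, x, hx, rfl⟩)
  obtain ⟨δ, hδ, hδY⟩ : ∃ δ > 0, ∀ y ∈ Y, δ ≤ ‖x - y‖ := by
    have : (Y : Set (H₀ →L[ℂ] H₀))ᶜ ∈ 𝓝 x :=
      (Submodule.isClosed_topologicalClosure _).isOpen_compl.mem_nhds hxJ
    obtain ⟨δ, hδ, hball⟩ := Metric.mem_nhds_iff.1 this
    refine ⟨δ, hδ, fun y hy ↦ ?_⟩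
    by_contra! hlt
    exact hball (by rwa [Metric.mem_ball, dist_comm, dist_eq_norm]) hy
  obtain ⟨l, hl, hlJ, hlu⟩ := exists_contractive_left_approximateUnit J hJ
    (fun a ha b hb ↦ (hideal a (hJA ha) b hb).1)
    (fun a ha b hb ↦ (hideal _ (star_mem (hJA hb)) a ha).2)
  have hvec (e : H₀ →L[ℂ] H₀) :
      ∃ h : H₀, ‖h‖ ≤ 1 ∧ (e ∈ J → δ / 2 ≤ ‖(x - e * x) h‖) := by
    by_cases he : e ∈ J
    · obtain ⟨h, h1, h2⟩ := (x - e * x).exists_lt_apply_of_lt_opNorm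
        ((half_lt_self hδ).trans_le (hδY _ (hYmem e he x hx)))
      exact ⟨h, h1.le, fun _ ↦ h2.le⟩
    · exact ⟨0, by simp, fun h ↦ absurd h he⟩
  choose h hh1 hh2 using hvec
  set U := Ultrafilter.of l
  have hUl : (U : Filter (H₀ →L[ℂ] H₀)) ≤ l := Ultrafilter.of_le l
  obtain ⟨φ, hφ⟩ := exists_positiveLinearMap_tendsto_inner U h hh1
  have hstar (T : H₀ →L[ℂ] H₀) : Tendsto (fun e ↦ ‖T (h e)‖ ^ 2) U
      (𝓝 (‖(φ.toPreGNS T : φ.GNS)‖ ^ 2)) := by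
    have h1 := (Complex.continuous_re.tendsto _).comp (hφ (star T * T))
    have h2 : (φ (star T * T)).re = ‖(φ.toPreGNS T : φ.GNS)‖ ^ 2 := by
      have := φ.preGNS_norm_sq (φ.toPreGNS T)
      rw [UniformSpace.Completion.norm_coe]
      simp only [PositiveLinearMap.ofPreGNS_toPreGNS] at this
      rw [← this]
      norm_cast
    rw [h2] at h1
    refine h1.congr fun e ↦ ?_
    simp [ContinuousLinearMap.star_eq_adjoint, ContinuousLinearMap.adjoint_inner_right,
      inner_self_eq_norm_sq_to_K]
    norm_cast
  have hΦ (a b : H₀ →L[ℂ] H₀) :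
      φ.gnsStarAlgHom a (φ.toPreGNS b : φ.GNS) = (φ.toPreGNS (a * b) : φ.GNS) :=
    φ.gnsNonUnitalStarAlgHom_apply_coe
  refine ⟨φ.GNS, inferInstance, inferInstance, inferInstance, φ.gnsStarAlgHom, ?_⟩
  refine SetLike.lt_iff_le_and_exists.2 ⟨Submodule.topologicalClosure_mono (Submodule.span_mono ?_),
    (φ.toPreGNS x : φ.GNS), ?_, fun hmem ↦ ?_⟩
  · rintro _ ⟨j, hj, x, hx, k, rfl⟩
    exact ⟨j * x, hAX j (hJA hj) x hx, k, by simp⟩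
  · refine Submodule.le_topologicalClosure _ (Submodule.subset_span
      ⟨x, hx, (φ.toPreGNS 1 : φ.GNS), ?_⟩)
    rw [hΦ, mul_one]
  have hconv : Tendsto (fun e ↦ φ.gnsStarAlgHom e (φ.toPreGNS x : φ.GNS)) l
      (𝓝 (φ.toPreGNS x : φ.GNS)) := by
    refine tendsto_apply_of_mem_topologicalClosure_span ?_ ?_ hmem
    · filter_upwards [hlJ] with e he
      exact (NonUnitalStarAlgHom.norm_apply_le φ.gnsStarAlgHom e).trans he.2
    · rintro _ ⟨j, hj, x, hx, k, rfl⟩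
      have hcont : Continuous φ.gnsStarAlgHom :=
        AddMonoidHomClass.continuous_of_bound φ.gnsStarAlgHom 1 fun a ↦ by
          simpa using NonUnitalStarAlgHom.norm_apply_le φ.gnsStarAlgHom a
      have h1 := (hcont.tendsto j).comp (hlu j hj)
      have h2 := ((ContinuousLinearMap.apply ℂ φ.GNS (φ.gnsStarAlgHom x k)).continuous.tendsto
        _).comp h1
      refine h2.congr fun e ↦ ?_
      simp
  obtain ⟨b, hbd, hbJ, -⟩ :=
    ((Metric.tendsto_nhds.1 hconv (δ / 8) (by positivity)).and hlJ).exists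
  have hnorm : ‖(φ.toPreGNS (x - b * x) : φ.GNS)‖ < δ / 8 := by
    rw [hΦ, dist_comm, dist_eq_norm] at hbd
    rwa [map_sub, UniformSpace.Completion.coe_sub]
  have hsmall : ∀ᶠ e in (U : Filter (H₀ →L[ℂ] H₀)), ‖(x - b * x) (h e)‖ < δ / 8 := by
    have hlt : ‖(φ.toPreGNS (x - b * x) : φ.GNS)‖ ^ 2 < (δ / 8) ^ 2 := by gcongr
    filter_upwards [(hstar (x - b * x)).eventually_lt_const hlt] with e he
    exact lt_of_pow_lt_pow_left₀ 2 (by positivity) he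
  have hb0 : ∀ᶠ e in l, ‖b - e * b‖ * ‖x‖ < δ / 4 := by
    have : Tendsto (fun e ↦ ‖b - e * b‖ * ‖x‖) l (𝓝 0) := by
      simpa using ((tendsto_const_nhds (x := b)).sub (hlu b hbJ)).norm.mul_const ‖x‖
    exact this.eventually_lt_const (by positivity)
  obtain ⟨e, hes, heb, heJ, he1⟩ := (hsmall.and ((hb0.and hlJ).filter_mono hUl)).exists
  have hdecomp : (x - e * x) (h e) =
      (x - b * x) (h e) - e ((x - b * x) (h e)) + ((b - e * b) * x) (h e) := by
    have hop : x - e * x = (x - b * x) - e * (x - b * x) + (b - e * b) * x := by noncomm_ring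
    rw [hop]
    rfl
  have h1 : ‖e ((x - b * x) (h e))‖ ≤ ‖(x - b * x) (h e)‖ := by
    simpa using e.le_of_opNorm_le he1 ((x - b * x) (h e))
  have h2 : ‖((b - e * b) * x) (h e)‖ ≤ ‖b - e * b‖ * ‖x‖ := by
    calc _ ≤ ‖(b - e * b) * x‖ * 1 := ContinuousLinearMap.le_opNorm_of_le _ (hh1 e)
      _ ≤ _ := by rw [mul_one]; exact norm_mul_le _ _
  have h3 := hh2 e heJ
  rw [hdecomp] at h3
  have h4 := h3.trans ((norm_add_le _ _).trans (add_le_add_left (norm_sub_le _ _) _))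
  linarith
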